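/- Given a multicritical circle map f with irrational rotation number, there exists a constant C > 1, depending only on f, such that the following holds: if M_i ⋐ T_i ⊂ S¹, where i runs through a finite index set 𝓘, are intervals on the circle such that the family {T_i : i ∈ 𝓘} has multiplicity of intersection at most m, then ∏_{i ∈ 𝓘} CrD(f; M_i, T_i) ≤ C^m. -/

import Mathlib

open Set Filter Topology
open scoped ENNReal

noncomputable section

namespace MCircle

/-- A lift of an orientation-preserving `C³` circle homeomorphism of `S¹ = ℝ/ℤ`:
a `C³`, strictly increasing map commuting with the unit translation. -/
structure IsCircleMapLift (f : ℝ → ℝ) : Prop where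
  smooth : ContDiff ℝ 3 f
  mono : StrictMono f
  periodic : ∀ x : ℝ, f (x + 1) = f x + 1

/-- `c` is a non-flat (power-law) critical point of `f` of criticality `d > 1`:
near `c` we have `f x = f c + φ x * |φ x| ^ (d - 1)` for a `C³` diffeomorphism `φ`
of a neighbourhood `W` of `c` with `φ c = 0`. -/
def IsNonFlatCritPt (f : ℝ → ℝ) (c d : ℝ) : Prop :=
  1 < d ∧ ∃ (W : Set ℝ) (φ : ℝ → ℝ), IsOpen W ∧ c ∈ W ∧
    ContDiffOn ℝ 3 φ W ∧ φ c = 0 ∧ (∀ x ∈ W, deriv φ x ≠ 0) ∧ InjOn φ W ∧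
    ∀ x ∈ W, f x = f c + φ x * |φ x| ^ (d - 1)

/-- `f` is (a lift of) a multicritical circle map: the set of critical points of the
induced circle map, represented in `[0,1)`, is the nonempty finite set `C`, and each
critical point `c ∈ C` is non-flat of criticality `dc c`. -/
def IsMulticriticalLift (f : ℝ → ℝ) (C : Finset ℝ) (dc : ℝ → ℝ) : Prop :=
  IsCircleMapLift f ∧ C.Nonempty ∧ (↑C : Set ℝ) ⊆ Ico (0 : ℝ) 1 ∧
    (∀ x : ℝ, deriv f x = 0 ↔ ∃ c ∈ C, ∃ k : ℤ, x = c + (k : ℝ)) ∧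
    ∀ c ∈ C, IsNonFlatCritPt f c (dc c)

/-- The lift `f` has (translation) rotation number `ρ`. -/
def HasRotNumber (f : ℝ → ℝ) (ρ : ℝ) : Prop :=
  Tendsto (fun n : ℕ => f^[n] 0 / (n : ℝ)) atTop (𝓝 ρ)

/-- `f` is (a lift of) a multicritical circle map with critical set `C` (criticalities
`dc`) and irrational rotation number `ρ`, the lift being normalized so that `ρ ∈ (0,1)`. -/
def GoodMap (f : ℝ → ℝ) (C : Finset ℝ) (dc : ℝ → ℝ) (ρ : ℝ) : Prop :=
  IsMulticriticalLift f C dc ∧ HasRotNumber f ρ ∧ Irrational ρ ∧ ρ ∈ Ioo (0 : ℝ) 1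

/-- The Gauss map. -/
def gaussMap (x : ℝ) : ℝ := Int.fract x⁻¹

/-- The partial quotients `aₙ` of the continued fraction expansion
`ρ = [a₀, a₁, …] = 1/(a₀ + 1/(a₁ + ⋯))`. -/
def cfA (ρ : ℝ) (n : ℕ) : ℕ := ⌊(gaussMap^[n] (Int.fract ρ))⁻¹⌋₊

/-- The denominators `qₙ` of the convergents of `ρ` (the return times):
`q₀ = 1`, `q₁ = a₀`, `q_{n+2} = a_{n+1} q_{n+1} + qₙ`. -/
def qden (ρ : ℝ) : ℕ → ℕ
  | 0 => 1
  | 1 => cfA ρ 0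
  | n + 2 => cfA ρ (n + 1) * qden ρ (n + 1) + qden ρ n

/-- The numerators `pₙ` of the convergents of `ρ`:
`p₀ = 0`, `p₁ = 1`, `p_{n+2} = a_{n+1} p_{n+1} + pₙ`. -/
def pnum (ρ : ℝ) : ℕ → ℕ
  | 0 => 0
  | 1 => 1
  | n + 2 => cfA ρ (n + 1) * pnum ρ (n + 1) + pnum ρ n

/-- The lift representative of the `n`-th closest return `f^{qₙ}(x)`,
normalized (by the integer `pₙ`) to lie at distance less than one from `x`. -/
def retPt (f : ℝ → ℝ) (ρ x : ℝ) (n : ℕ) : ℝ := f^[qden ρ n] x - (pnum ρ n : ℝ)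

/-- The arc `Iₙ(x)`, with endpoints `x` and `f^{qₙ}(x)` and containing `f^{q_{n+2}}(x)`,
realized as an interval in the lift. -/
def arcI (f : ℝ → ℝ) (ρ x : ℝ) (n : ℕ) : Set ℝ := uIcc x (retPt f ρ x n)

/-- The length `|Iₙ(x)|`. -/
def arcLen (f : ℝ → ℝ) (ρ x : ℝ) (n : ℕ) : ℝ := |retPt f ρ x n - x|

/-- The length `|f^j(Iₙ(x))|`. -/
def arcImgLen (f : ℝ → ℝ) (ρ x : ℝ) (n j : ℕ) : ℝ :=
  |f^[j] (retPt f ρ x n) - f^[j] x|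

/-- Indices for the atoms of the `n`-th dynamical partition
`𝒫ₙ(x) = {fⁱ(Iₙ(x)) : 0 ≤ i ≤ q_{n+1}-1} ∪ {f^j(I_{n+1}(x)) : 0 ≤ j ≤ qₙ-1}`. -/
abbrev AtomIdx (ρ : ℝ) (n : ℕ) : Type :=
  {i : ℕ // i < qden ρ (n + 1)} ⊕ {j : ℕ // j < qden ρ n}

/-- Left endpoint (in the lift) of an atom of `𝒫ₙ(x)`. -/
def atomL (f : ℝ → ℝ) (ρ x : ℝ) (n : ℕ) : AtomIdx ρ n → ℝ
  | Sum.inl i => min (f^[i.1] x) (f^[i.1] (retPt f ρ x n))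
  | Sum.inr j => min (f^[j.1] x) (f^[j.1] (retPt f ρ x (n + 1)))

/-- Right endpoint (in the lift) of an atom of `𝒫ₙ(x)`. -/
def atomR (f : ℝ → ℝ) (ρ x : ℝ) (n : ℕ) : AtomIdx ρ n → ℝ
  | Sum.inl i => max (f^[i.1] x) (f^[i.1] (retPt f ρ x n))
  | Sum.inr j => max (f^[j.1] x) (f^[j.1] (retPt f ρ x (n + 1)))

/-- Length of an atom of `𝒫ₙ(x)`. -/
def atomLen (f : ℝ → ℝ) (ρ x : ℝ) (n : ℕ) (A : AtomIdx ρ n) : ℝ :=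
  atomR f ρ x n A - atomL f ρ x n A

/-- Two lift points represent the same point of the circle `ℝ/ℤ`. -/
def SameCirclePt (a b : ℝ) : Prop := ∃ m : ℤ, a = b + (m : ℝ)

/-- Two atoms of `𝒫ₙ(x)` are adjacent: they are distinct and share an endpoint
on the circle. -/
def AdjacentAtoms (f : ℝ → ℝ) (ρ x : ℝ) (n : ℕ) (A B : AtomIdx ρ n) : Prop :=
  A ≠ B ∧ ∃ p ∈ ({atomL f ρ x n A, atomR f ρ x n A} : Set ℝ),
    ∃ q ∈ ({atomL f ρ x n B, atomR f ρ x n B} : Set ℝ), SameCirclePt p q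

/-- `A` is the left neighbour of `Δ` in `𝒫ₙ(x)`. -/
def IsLeftNbr (f : ℝ → ℝ) (ρ x : ℝ) (n : ℕ) (A Δ : AtomIdx ρ n) : Prop :=
  A ≠ Δ ∧ SameCirclePt (atomR f ρ x n A) (atomL f ρ x n Δ)

/-- `B` is the right neighbour of `Δ` in `𝒫ₙ(x)`. -/
def IsRightNbr (f : ℝ → ℝ) (ρ x : ℝ) (n : ℕ) (B Δ : AtomIdx ρ n) : Prop :=
  B ≠ Δ ∧ SameCirclePt (atomL f ρ x n B) (atomR f ρ x n Δ)

/-- The arc `f^j(Δ)` is contained (as a circle arc) in some element of `𝒫ₙ(x)`. -/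
def ImgInAtom (f : ℝ → ℝ) (ρ x : ℝ) (n j : ℕ) (Δ : AtomIdx ρ n) : Prop :=
  ∃ E : AtomIdx ρ n, ∃ m : ℤ,
    atomL f ρ x n E + (m : ℝ) ≤ f^[j] (atomL f ρ x n Δ) ∧
    f^[j] (atomR f ρ x n Δ) ≤ atomR f ρ x n E + (m : ℝ)

/-- An atom of `𝒫ₙ(x)` as a subset of the circle `ℝ/ℤ`. -/
def atomSetC (f : ℝ → ℝ) (ρ x : ℝ) (n : ℕ) (A : AtomIdx ρ n) : Set (AddCircle (1 : ℝ)) :=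
  (fun y : ℝ => (y : AddCircle (1 : ℝ))) '' Icc (atomL f ρ x n A) (atomR f ρ x n A)

/-- The interval `Tₙ = I_{n+1} ∪ Iₙ ∪ f^{qₙ}(Iₙ)`, realized in the lift. -/
def Tset (f : ℝ → ℝ) (ρ x : ℝ) (n : ℕ) : Set ℝ :=
  arcI f ρ x (n + 1) ∪ arcI f ρ x n ∪
    (fun z => f^[qden ρ n] z - (pnum ρ n : ℝ)) '' arcI f ρ x n

/-- `j` is a critical time: `f^j(Tₙ)` contains a critical point of `f` (mod 1). -/
def IsCritTime (f : ℝ → ℝ) (ρ x : ℝ) (C : Finset ℝ) (n j : ℕ) : Prop :=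
  ∃ c ∈ C, ∃ m : ℤ, c + (m : ℝ) ∈ f^[j] '' Tset f ρ x n

/-- The cross-ratio `[M,T] = |L||R|/(|L∪M||M∪R|)` of the configuration
`M = [b,c] ⋐ T = [a,d]` (so `L = [a,b]`, `R = [c,d]`). -/
def crossRatio (a b c d : ℝ) : ℝ := ((b - a) * (d - c)) / ((c - a) * (d - b))

/-- The cross-ratio distortion `CrD(g; M, T)` of `g` on the configuration
`M = [b,c] ⋐ T = [a,d]`. -/
def crD (g : ℝ → ℝ) (a b c d : ℝ) : ℝ :=
  crossRatio (g a) (g b) (g c) (g d) / crossRatio a b c d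

/-- The Schwarzian derivative `Sg = g'''/g' - (3/2)(g''/g')²`. -/
def schwarzian (g : ℝ → ℝ) (x : ℝ) : ℝ :=
  iteratedDeriv 3 g x / deriv g x - (3 / 2) * (iteratedDeriv 2 g x / deriv g x) ^ 2

/-- `g` is a diffeomorphism on `S` with distortion bounded by `K`. -/
def DiffeoWithDistortionLE (g : ℝ → ℝ) (S : Set ℝ) (K : ℝ) : Prop :=
  ContDiffOn ℝ 1 g S ∧ InjOn g S ∧ (∀ x ∈ S, deriv g x ≠ 0) ∧
    ∀ x ∈ S, ∀ y ∈ S, |deriv g x| ≤ K * |deriv g y|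

/-- `g` is a diffeomorphism on `S` with negative Schwarzian derivative. -/
def NegSchwarzDiffeoOn (g : ℝ → ℝ) (S : Set ℝ) : Prop :=
  ContDiffOn ℝ 3 g S ∧ InjOn g S ∧ ∀ x ∈ S, deriv g x ≠ 0 ∧ schwarzian g x < 0

/-- The local quasi-symmetric distortion
`σ_h(x) = lim_{δ→0} limsup_{|t|≤δ} |h(x+t)-h(x)|/|h(x)-h(x-t)|` of a circle
homeomorphism lift `h`, with values in `[0,∞]`. -/
def qsDistortion (h : ℝ → ℝ) (x : ℝ) : ℝ≥0∞ :=
  Filter.limsup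
    (fun t : ℝ => ENNReal.ofReal (|h (x + t) - h x| / |h x - h (x - t)|))
    (𝓝[≠] (0 : ℝ))

end MCircle

open MCircle

theorem crD_eq_slope (g : ℝ → ℝ) (a b c d : ℝ) :
    crD g a b c d = slope g a b * slope g c d / (slope g a c * slope g b d) := by
  simp only [crD, crossRatio, slope_def_field, div_eq_mul_inv, mul_inv, inv_inv]
  ring

theorem slope_comp_eq_mul {g φ : ℝ → ℝ} {x y : ℝ} (h : φ x ≠ φ y) :
    slope (g ∘ φ) x y = slope g (φ x) (φ y) * slope φ x y := by
  simp only [slope_def_field, Function.comp]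
  rw [div_mul_div_cancel₀ (sub_ne_zero.2 h.symm)]

/-- The odd power function `y ↦ y |y| ^ (p - 1)`. -/
def signedPow (p y : ℝ) : ℝ := y * |y| ^ (p - 1)

theorem signedPow_neg (p y : ℝ) : signedPow p (-y) = -signedPow p y := by
  simp [signedPow]

theorem signedPow_of_pos {p y : ℝ} (hy : 0 < y) : signedPow p y = y ^ p := by
  rw [signedPow, abs_of_pos hy, Real.rpow_sub_one hy.ne']
  field_simp

theorem slope_signedPow_neg (p x y : ℝ) :
    slope (signedPow p) (-y) (-x) = slope (signedPow p) x y := by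
  simp only [slope_def_field, signedPow_neg]
  congr 1 <;> ring

theorem signedPow_sub_le_of_nonneg {p u v : ℝ} (hp : 1 ≤ p) (hu : 0 ≤ u) (huv : u ≤ v) :
    signedPow p v - signedPow p u ≤ p * v ^ (p - 1) * (v - u) := by
  rcases hu.eq_or_lt with rfl | hu
  · rcases huv.eq_or_lt with rfl | hv
    · simp
    · rw [signedPow, signedPow, abs_of_pos hv]
      have := mul_nonneg (sub_nonneg.2 hp) (mul_nonneg (Real.rpow_nonneg hv.le (p - 1)) hv.le)
      linarith
  · have hv : 0 < v := hu.trans_le huv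
    have h := one_add_mul_self_le_rpow_one_add (s := u / v - 1)
      (by have := div_pos hu hv; linarith) hp
    rw [add_sub_cancel, Real.div_rpow hu.le hv.le, le_div_iff₀ (Real.rpow_pos_of_pos hv p)] at h
    rw [signedPow_of_pos hv, signedPow_of_pos hu, Real.rpow_sub_one hv.ne']
    have e : (1 + p * (u / v - 1)) * v ^ p = v ^ p - p * (v ^ p / v) * (v - u) := by
      field_simp
      ring
    linarith

theorem signedPow_sub_le {p u v M : ℝ} (hp : 1 ≤ p) (hu : |u| ≤ M) (hv : |v| ≤ M) (huv : u ≤ v) :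
    signedPow p v - signedPow p u ≤ p * M ^ (p - 1) * (v - u) := by
  have hM : 0 ≤ M := (abs_nonneg u).trans hu
  have mono : ∀ y, 0 ≤ y → y ≤ M → y ^ (p - 1) ≤ M ^ (p - 1) := fun y h0 h1 =>
    Real.rpow_le_rpow h0 h1 (by linarith)
  rcases le_total 0 u with h0u | hu0
  · refine (signedPow_sub_le_of_nonneg hp h0u huv).trans ?_
    have := mono v (h0u.trans huv) ((le_abs_self v).trans hv)
    have : 0 ≤ v - u := sub_nonneg.2 huv
    gcongr
  rcases le_total v 0 with hv0 | h0v
  · have h := signedPow_sub_le_of_nonneg hp (neg_nonneg.2 hv0) (neg_le_neg huv)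
    rw [signedPow_neg, signedPow_neg] at h
    have := mono (-u) (neg_nonneg.2 hu0) ((neg_le_abs u).trans hu)
    have h0 : 0 ≤ v - u := sub_nonneg.2 huv
    calc signedPow p v - signedPow p u = -signedPow p u - -signedPow p v := by ring
      _ ≤ p * (-u) ^ (p - 1) * (v - u) := by linarith
      _ ≤ _ := by gcongr
  · rw [signedPow, signedPow]
    have h1 := mul_le_mul_of_nonneg_left (mono |v| (abs_nonneg v) hv) h0v
    have h2 := mul_le_mul_of_nonneg_left (mono |u| (abs_nonneg u) hu) (neg_nonneg.2 hu0)
    have h3 := mul_nonneg (mul_nonneg (sub_nonneg.2 hp) (Real.rpow_nonneg hM (p - 1)))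
      (sub_nonneg.2 huv)
    linarith

theorem le_signedPow_sub_of_abs_le {p u w : ℝ} (hp : 1 ≤ p) (huw : u ≤ w) (h : |u| ≤ w) :
    w ^ (p - 1) * (w - u) / 2 ≤ signedPow p w - signedPow p u := by
  have hw : 0 ≤ w := (abs_nonneg u).trans h
  have hpos : 0 ≤ w ^ (p - 1) := Real.rpow_nonneg hw _
  rw [signedPow, signedPow, abs_of_nonneg hw]
  rcases le_total 0 u with hu | hu
  · have := mul_le_mul_of_nonneg_left (Real.rpow_le_rpow (abs_nonneg u) h (sub_nonneg.2 hp)) hu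
    have := mul_nonneg hpos (sub_nonneg.2 huw)
    linarith
  · have := mul_nonneg (neg_nonneg.2 hu) (Real.rpow_nonneg (abs_nonneg u) (p - 1))
    have := mul_nonneg hpos (by linarith [neg_le_abs u] : 0 ≤ w + u)
    linarith

theorem le_signedPow_sub {p u w : ℝ} (hp : 1 ≤ p) (huw : u ≤ w) :
    max |u| |w| ^ (p - 1) * (w - u) / 2 ≤ signedPow p w - signedPow p u := by
  rcases le_total |u| |w| with h | h
  · rw [max_eq_right h]
    rcases le_total 0 w with hw | hw
    · rw [abs_of_nonneg hw] at h ⊢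
      exact le_signedPow_sub_of_abs_le hp huw h
    · rw [abs_of_nonpos hw, abs_of_nonpos (huw.trans hw)] at h
      obtain rfl : u = w := by linarith
      simp
  · rw [max_eq_left h]
    rcases le_total 0 u with hu | hu
    · rw [abs_of_nonneg hu, abs_of_nonneg (hu.trans huw)] at h
      obtain rfl : u = w := by linarith
      simp
    · rw [abs_of_nonpos hu] at h ⊢
      have := le_signedPow_sub_of_abs_le hp (neg_le_neg huw) (by rwa [abs_neg])
      rw [signedPow_neg, signedPow_neg] at this
      linarith

theorem strictMono_signedPow {p : ℝ} (hp : 1 ≤ p) : StrictMono (signedPow p) := by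
  intro u w huw
  have h := le_signedPow_sub hp huw.le
  have hM : 0 < max |u| |w| := by
    by_contra hM
    have h1 := abs_nonpos_iff.1 ((le_max_left |u| |w|).trans (not_lt.1 hM))
    have h2 := abs_nonpos_iff.1 ((le_max_right |u| |w|).trans (not_lt.1 hM))
    linarith
  have := mul_pos (Real.rpow_pos_of_pos hM (p - 1)) (sub_pos.2 huw)
  linarith

theorem slope_pos_of_strictMono {g : ℝ → ℝ} (hg : StrictMono g) {x y : ℝ} (hxy : x < y) :
    0 < slope g x y := by
  rw [slope_def_field]
  exact div_pos (sub_pos.2 (hg hxy)) (sub_pos.2 hxy)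

theorem slope_signedPow_le {p u x y w : ℝ} (hp : 1 ≤ p) (hux : u ≤ x) (hxy : x < y) (hyw : y ≤ w) :
    slope (signedPow p) x y ≤ 2 * p * slope (signedPow p) u w := by
  have huw : u < w := by linarith
  have hM : ∀ z, u ≤ z → z ≤ w → |z| ≤ max |u| |w| := fun z h1 h2 => abs_le_max_abs_abs h1 h2
  have h1 := signedPow_sub_le hp (hM x hux (by linarith)) (hM y (by linarith) hyw) hxy.le
  have h2 := le_signedPow_sub hp huw.le
  rw [slope_def_field, slope_def_field]
  calc _ ≤ p * max |u| |w| ^ (p - 1) := (div_le_iff₀ (sub_pos.2 hxy)).2 h1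
    _ = 2 * p * (max |u| |w| ^ (p - 1) * (w - u) / 2 / (w - u)) := by
      have := sub_pos.2 huw
      field_simp
    _ ≤ _ := by
      have := sub_pos.2 huw
      gcongr

theorem sinh_mul_div_sinh_monotoneOn {p : ℝ} (hp : 1 ≤ p) :
    MonotoneOn (fun x => Real.sinh (p * x) / Real.sinh x) (Ioi 0) := by
  have key : ∀ x ∈ Ici (0 : ℝ),
      0 ≤ p * Real.cosh (p * x) * Real.sinh x - Real.sinh (p * x) * Real.cosh x := by
    have hd : ∀ x, HasDerivAt
        (fun x => p * Real.cosh (p * x) * Real.sinh x - Real.sinh (p * x) * Real.cosh x)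
        ((p ^ 2 - 1) * Real.sinh (p * x) * Real.sinh x) x := by
      intro x
      have hl : HasDerivAt (fun x => p * x) p x := by simpa using (hasDerivAt_id x).const_mul p
      have h := ((hl.cosh.const_mul p).mul (Real.hasDerivAt_sinh x)).sub
        (hl.sinh.mul (Real.hasDerivAt_cosh x))
      refine h.congr_deriv ?_
      ring
    have hm := monotoneOn_of_deriv_nonneg (convex_Ici (0 : ℝ))
      (fun x _ => (hd x).continuousAt.continuousWithinAt)
      (fun x _ => (hd x).differentiableAt.differentiableWithinAt) (by
        intro x hx
        rw [interior_Ici] at hx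
        rw [(hd x).deriv]
        have hx : 0 < x := hx
        have h1 := Real.sinh_pos_iff.2 hx
        have h2 := Real.sinh_pos_iff.2 (mul_pos (by linarith : 0 < p) hx)
        have h3 : 0 ≤ p ^ 2 - 1 := by nlinarith
        positivity)
    intro x hx
    simpa using hm (self_mem_Ici) hx hx
  have hd : ∀ x ∈ Ioi (0 : ℝ), HasDerivAt (fun x => Real.sinh (p * x) / Real.sinh x)
      ((p * Real.cosh (p * x) * Real.sinh x - Real.sinh (p * x) * Real.cosh x) /
        Real.sinh x ^ 2) x := by
    intro x hx
    have hl : HasDerivAt (fun x => p * x) p x := by simpa using (hasDerivAt_id x).const_mul p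
    have h := hl.sinh.div (Real.hasDerivAt_sinh x) (Real.sinh_pos_iff.2 hx).ne'
    refine h.congr_deriv ?_
    ring
  refine monotoneOn_of_deriv_nonneg (convex_Ioi 0)
    (fun x hx => (hd x hx).continuousAt.continuousWithinAt) ?_ ?_
  · rw [interior_Ioi]
    exact fun x hx => (hd x hx).differentiableAt.differentiableWithinAt
  · rw [interior_Ioi]
    intro x hx
    rw [(hd x hx).deriv]
    exact div_nonneg (key x (mem_Ici.2 (le_of_lt hx))) (sq_nonneg _)

theorem exp_two_mul_sub_exp_two_mul (s t : ℝ) :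
    Real.exp (2 * t) - Real.exp (2 * s) = 2 * Real.exp (s + t) * Real.sinh (t - s) := by
  have h1 : Real.exp (2 * t) = Real.exp (s + t) * Real.exp (t - s) := by
    rw [← Real.exp_add]; congr 1; ring
  have h2 : Real.exp (2 * s) = Real.exp (s + t) * Real.exp (-(t - s)) := by
    rw [← Real.exp_add]; congr 1; ring
  rw [h1, h2, Real.sinh_eq]
  ring

theorem slope_signedPow_exp (p s t : ℝ) :
    slope (signedPow p) (Real.exp (2 * s)) (Real.exp (2 * t)) =
      Real.exp ((p - 1) * s) * Real.exp ((p - 1) * t) *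
        (Real.sinh (p * (t - s)) / Real.sinh (t - s)) := by
  have e : ∀ r, signedPow p (Real.exp (2 * r)) = Real.exp (2 * (p * r)) := fun r => by
    rw [signedPow_of_pos (Real.exp_pos _), ← Real.exp_mul]; congr 1; ring
  rw [slope_def_field, e, e, exp_two_mul_sub_exp_two_mul, exp_two_mul_sub_exp_two_mul,
    ← Real.exp_add]
  have h : Real.exp (p * s + p * t) =
      Real.exp ((p - 1) * s + (p - 1) * t) * Real.exp (s + t) := by
    rw [← Real.exp_add]; congr 1; ring
  have h0 := (Real.exp_pos (s + t)).ne'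
  rw [h, ← mul_sub]
  field_simp

theorem slope_signedPow_mul_le_of_pos {p a b c d : ℝ} (hp : 1 ≤ p) (ha : 0 < a) (hab : a < b)
    (hbc : b < c) (hcd : c < d) :
    slope (signedPow p) a b * slope (signedPow p) c d ≤
      slope (signedPow p) a c * slope (signedPow p) b d := by
  obtain ⟨s, rfl⟩ : ∃ s, a = Real.exp (2 * s) :=
    ⟨Real.log a / 2, by rw [mul_div_cancel₀ _ two_ne_zero, Real.exp_log ha]⟩
  obtain ⟨t, rfl⟩ : ∃ s, b = Real.exp (2 * s) :=
    ⟨Real.log b / 2, by rw [mul_div_cancel₀ _ two_ne_zero, Real.exp_log (by linarith)]⟩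
  obtain ⟨u, rfl⟩ : ∃ s, c = Real.exp (2 * s) :=
    ⟨Real.log c / 2, by rw [mul_div_cancel₀ _ two_ne_zero, Real.exp_log (by linarith)]⟩
  obtain ⟨v, rfl⟩ : ∃ s, d = Real.exp (2 * s) :=
    ⟨Real.log d / 2, by rw [mul_div_cancel₀ _ two_ne_zero, Real.exp_log (by linarith)]⟩
  rw [Real.exp_lt_exp] at hab hbc hcd
  have hR := sinh_mul_div_sinh_monotoneOn hp
  have hpos : ∀ x, 0 < x → 0 < Real.sinh (p * x) / Real.sinh x := fun x hx =>
    div_pos (Real.sinh_pos_iff.2 (mul_pos (by linarith) hx)) (Real.sinh_pos_iff.2 hx)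
  have h1 := hR (mem_Ioi.2 (by linarith : 0 < t - s)) (mem_Ioi.2 (by linarith : 0 < u - s))
    (by linarith)
  have h2 := hR (mem_Ioi.2 (by linarith : 0 < v - u)) (mem_Ioi.2 (by linarith : 0 < v - t))
    (by linarith)
  have h3 := mul_le_mul h1 h2 (hpos _ (by linarith)).le (hpos _ (by linarith)).le
  simp only [slope_signedPow_exp]
  have h4 : 0 ≤ Real.exp ((p - 1) * s) * Real.exp ((p - 1) * t) * Real.exp ((p - 1) * u) *
    Real.exp ((p - 1) * v) := by positivity
  have h5 := mul_le_mul_of_nonneg_left h3 h4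
  calc _ = _ := by ring
    _ ≤ _ := h5
    _ = _ := by ring

theorem slope_signedPow_mul_le {p a b c d : ℝ} (hp : 1 ≤ p) (hab : a < b) (hbc : b < c)
    (hcd : c < d) (h : 0 ∉ Icc a d) :
    slope (signedPow p) a b * slope (signedPow p) c d ≤
      slope (signedPow p) a c * slope (signedPow p) b d := by
  rcases lt_or_ge 0 a with ha | ha
  · exact slope_signedPow_mul_le_of_pos hp ha hab hbc hcd
  · have hd : d < 0 := not_le.1 fun hd => h ⟨ha, hd⟩
    have := slope_signedPow_mul_le_of_pos hp (neg_pos.2 hd) (neg_lt_neg hcd) (neg_lt_neg hbc)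
      (neg_lt_neg hab)
    simp only [slope_signedPow_neg] at this
    linarith

theorem map_add_intCast_of_periodic {f : ℝ → ℝ} (hper : ∀ x, f (x + 1) = f x + 1) (x : ℝ) (k : ℤ) :
    f (x + k) = f x + k := by
  have := AddConstMapClass.map_add_int (⟨f, hper⟩ : AddConstMap ℝ ℝ 1 1) x k
  simpa using this

theorem exists_signedPow_chart {f : ℝ → ℝ} {C : Finset ℝ} {dc : ℝ → ℝ}
    (hf : IsMulticriticalLift f C dc) (x₀ : ℝ) :
    ∃ (p : ℝ) (φ : ℝ → ℝ), 1 ≤ p ∧ ContDiffAt ℝ 2 φ x₀ ∧ φ x₀ = 0 ∧ 0 < deriv φ x₀ ∧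
      ∀ᶠ x in 𝓝 x₀, f x = f x₀ + signedPow p (φ x) := by
  obtain ⟨⟨hsm, hmono, hper⟩, -, -, hcrit, hflat⟩ := hf
  suffices h : ∃ (p : ℝ) (φ : ℝ → ℝ), 1 ≤ p ∧ ContDiffAt ℝ 2 φ x₀ ∧ φ x₀ = 0 ∧
      deriv φ x₀ ≠ 0 ∧ ∀ᶠ x in 𝓝 x₀, f x = f x₀ + signedPow p (φ x) by
    obtain ⟨p, φ, hp, hφ, h0, hd, hev⟩ := h
    refine ⟨p, φ, hp, hφ, h0, lt_of_le_of_ne ?_ hd.symm, hev⟩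
    have hder := (hφ.differentiableAt (by norm_num)).hasDerivAt
    have ht := (hasDerivAt_iff_tendsto_slope.1 hder).mono_left
      (nhdsWithin_mono x₀ (fun x (hx : x₀ < x) => hx.ne') : 𝓝[>] x₀ ≤ 𝓝[≠] x₀)
    refine ge_of_tendsto ht ?_
    filter_upwards [self_mem_nhdsWithin, hev.filter_mono nhdsWithin_le_nhds] with x hx hfx
    have hx : x₀ < x := hx
    have h1 : signedPow p 0 < signedPow p (φ x) := by
      have := hmono hx
      simp only [signedPow, zero_mul]
      simp only [signedPow] at hfx
      linarith
    have h2 := (strictMono_signedPow hp).lt_iff_lt.1 h1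
    rw [slope_def_field, h0]
    exact div_nonneg (by linarith) (by linarith)
  by_cases hx₀ : deriv f x₀ = 0
  · obtain ⟨c, hc, k, rfl⟩ := (hcrit x₀).1 hx₀
    obtain ⟨hd, W, φ, hW, hcW, hφ, h0, hφ', -, hform⟩ := hflat c hc
    have hperk : ∀ x, f (x + k) = f x + k := fun x => map_add_intCast_of_periodic hper x k
    refine ⟨dc c, fun x => φ (x - k), hd.le, ?_, by simpa using h0, ?_, ?_⟩
    · have h1 : ContDiffAt ℝ 2 φ (c + k - k) := by
        rw [add_sub_cancel_right]
        exact (hφ.contDiffAt (hW.mem_nhds hcW)).of_le (by norm_num)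
      exact h1.comp (c + k : ℝ) (contDiffAt_id.sub contDiffAt_const)
    · rw [deriv_comp_sub_const, add_sub_cancel_right]
      exact hφ' c hcW
    · have hcont : Tendsto (fun x : ℝ => x - k) (𝓝 (c + k)) (𝓝 c) := by
        have : Continuous fun x : ℝ => x - k := by fun_prop
        simpa using this.tendsto (c + k : ℝ)
      filter_upwards [hcont.eventually (hW.mem_nhds hcW)] with x hx
      have h1 := hform (x - k) hx
      have h2 := hperk (x - k)
      rw [sub_add_cancel] at h2
      rw [h2, hperk, h1, signedPow]
      ring
  · refine ⟨1, fun x => f x - f x₀, le_rfl, ?_, sub_self _, ?_, ?_⟩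
    · exact (hsm.contDiffAt.of_le (by norm_num)).sub contDiffAt_const
    · rwa [deriv_sub_const]
    · filter_upwards with x
      simp [signedPow]

theorem slope_le_exp_mul_slope {φ : ℝ → ℝ} {lo K a d u v x y : ℝ} (hlo : 0 < lo) (hK : 0 ≤ K)
    (hdiff : ∀ z ∈ Icc a d, DifferentiableAt ℝ φ z) (hder : ∀ z ∈ Icc a d, lo ≤ deriv φ z)
    (hlip : ∀ z ∈ Icc a d, ∀ z' ∈ Icc a d, |deriv φ z - deriv φ z'| ≤ K * |z - z'|)
    (hx : a ≤ x) (hxy : x < y) (hy : y ≤ d) (hu : a ≤ u) (huv : u < v) (hv : v ≤ d) :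
    slope φ x y ≤ Real.exp (K / lo * (d - a)) * slope φ u v := by
  have mvt : ∀ s t, a ≤ s → s < t → t ≤ d → ∃ z ∈ Icc a d, deriv φ z = slope φ s t := by
    intro s t hs hst ht
    obtain ⟨z, hz, h⟩ := exists_deriv_eq_slope' φ hst
      (fun z hz => (hdiff z ⟨hs.trans hz.1, hz.2.trans ht⟩).continuousAt.continuousWithinAt)
      (fun z hz => (hdiff z ⟨hs.trans hz.1.le,
        hz.2.le.trans ht⟩).differentiableWithinAt)
    exact ⟨z, ⟨hs.trans hz.1.le, hz.2.le.trans ht⟩, h⟩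
  obtain ⟨z, hz, ez⟩ := mvt x y hx hxy hy
  obtain ⟨z', hz', ez'⟩ := mvt u v hu huv hv
  rw [← ez, ← ez']
  have h1 := (le_abs_self _).trans (hlip z hz z' hz')
  have h2 : |z - z'| ≤ d - a := abs_le.2 ⟨by linarith [hz.1, hz'.2], by linarith [hz.2, hz'.1]⟩
  have h3 := mul_le_mul_of_nonneg_left h2 hK
  have h4 : K * (d - a) ≤ K / lo * (d - a) * deriv φ z' := by
    have h5 : 0 ≤ K / lo * (d - a) :=
      mul_nonneg (div_nonneg hK hlo.le) (by linarith)
    calc K * (d - a) = K / lo * (d - a) * lo := by field_simp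
      _ ≤ _ := mul_le_mul_of_nonneg_left (hder z' hz') h5
  have h5 := mul_le_mul_of_nonneg_right (Real.add_one_le_exp (K / lo * (d - a)))
    (hlo.le.trans (hder z' hz'))
  linarith

theorem crD_le_of_slope_mul_le {f : ℝ → ℝ} (hf : StrictMono f) {a b c d E : ℝ} (hab : a < b)
    (hbc : b < c) (hcd : c < d)
    (h : slope f a b * slope f c d ≤ E * (slope f a c * slope f b d)) :
    crD f a b c d ≤ E := by
  rw [crD_eq_slope]
  exact (div_le_iff₀ (mul_pos (slope_pos_of_strictMono hf (hab.trans hbc))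
    (slope_pos_of_strictMono hf (hbc.trans hcd)))).2 h

theorem exists_local_bounds {f : ℝ → ℝ} {C : Finset ℝ} {dc : ℝ → ℝ}
    (hf : IsMulticriticalLift f C dc) (x₀ : ℝ) :
    ∃ ε B K : ℝ, 0 < ε ∧ 0 ≤ B ∧ 0 ≤ K ∧
      (∀ u x y w, u ∈ Metric.ball x₀ ε → w ∈ Metric.ball x₀ ε → u ≤ x → x < y → y ≤ w →
        slope f x y ≤ B * slope f u w) ∧
      (∀ a b c d, a ∈ Metric.ball x₀ ε → d ∈ Metric.ball x₀ ε → a < b → b < c → c < d →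
        x₀ ∉ Icc a d → crD f a b c d ≤ Real.exp (K * (d - a))) := by
  obtain ⟨p, φ, hp, hφ, h0, hpos, hform⟩ := exists_signedPow_chart hf x₀
  have hderiv : ContDiffAt ℝ 1 (deriv φ) x₀ := hφ.derivWithin (by norm_num)
  obtain ⟨K, s, hs, hlip⟩ := hderiv.exists_lipschitzOnWith
  set lo := deriv φ x₀ / 2
  have hlo : 0 < lo := half_pos hpos
  have hev1 : ∀ᶠ x in 𝓝 x₀, lo < deriv φ x :=
    hderiv.continuousAt.eventually (lt_mem_nhds (half_lt_self hpos))
  have hev2 : ∀ᶠ x in 𝓝 x₀, DifferentiableAt ℝ φ x :=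
    (hφ.eventually (by norm_num)).mono fun x hx => hx.differentiableAt (by norm_num)
  obtain ⟨ε, hε, hball⟩ := Metric.eventually_nhds_iff_ball.1
    (((hform.and hev1).and hev2).and hs)
  have hsub : ∀ {a d}, a ∈ Metric.ball x₀ ε → d ∈ Metric.ball x₀ ε → Icc a d ⊆ Metric.ball x₀ ε :=
    fun ha hd => (convex_ball x₀ ε).ordConnected.out ha hd
  have hdiff : ∀ {a d}, a ∈ Metric.ball x₀ ε → d ∈ Metric.ball x₀ ε →
      ∀ z ∈ Icc a d, DifferentiableAt ℝ φ z := fun ha hd z hz => (hball z (hsub ha hd hz)).1.2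
  have hder : ∀ {a d}, a ∈ Metric.ball x₀ ε → d ∈ Metric.ball x₀ ε →
      ∀ z ∈ Icc a d, lo ≤ deriv φ z := fun ha hd z hz => (hball z (hsub ha hd hz)).1.1.2.le
  have hlip' : ∀ {a d}, a ∈ Metric.ball x₀ ε → d ∈ Metric.ball x₀ ε →
      ∀ z ∈ Icc a d, ∀ z' ∈ Icc a d, |deriv φ z - deriv φ z'| ≤ K * |z - z'| :=
    fun ha hd z hz z' hz' => by
      simpa [Real.dist_eq] using hlip.dist_le_mul z (hball z (hsub ha hd hz)).2
        z' (hball z' (hsub ha hd hz')).2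
  have hφmono : StrictMonoOn φ (Metric.ball x₀ ε) := by
    refine strictMonoOn_of_deriv_pos (convex_ball x₀ ε)
      (fun z hz => (hball z hz).1.2.continuousAt.continuousWithinAt) fun z hz => ?_
    exact hlo.trans (hball z (interior_subset hz)).1.1.2
  have hfslope : ∀ x ∈ Metric.ball x₀ ε, ∀ y ∈ Metric.ball x₀ ε, x < y →
      slope f x y = slope (signedPow p) (φ x) (φ y) * slope φ x y := by
    intro x hx y hy hxy
    rw [← slope_comp_eq_mul (hφmono hx hy hxy).ne, slope_def_field, slope_def_field,
      (hball x hx).1.1.1, (hball y hy).1.1.1, Function.comp, Function.comp,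
      add_sub_add_left_eq_sub]
  have hqpos : ∀ x ∈ Metric.ball x₀ ε, ∀ y ∈ Metric.ball x₀ ε, x < y →
      0 < slope (signedPow p) (φ x) (φ y) := fun x hx y hy hxy =>
    slope_pos_of_strictMono (strictMono_signedPow hp) (hφmono hx hy hxy)
  have hφpos : ∀ x ∈ Metric.ball x₀ ε, ∀ y ∈ Metric.ball x₀ ε, x < y → 0 < slope φ x y := by
    intro x hx y hy hxy
    rw [slope_def_field]
    exact div_pos (sub_pos.2 (hφmono hx hy hxy)) (sub_pos.2 hxy)
  refine ⟨ε, 2 * p * Real.exp (K / lo * (2 * ε)), K / lo + K / lo, hε, by positivity,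
    by positivity, ?_, ?_⟩
  · intro u x y w hu hw hux hxy hyw
    have hx := hsub hu hw ⟨hux, hxy.le.trans hyw⟩
    have hy := hsub hu hw ⟨hux.trans hxy.le, hyw⟩
    have huw : u < w := by linarith
    have h1 := slope_signedPow_le hp (hφmono.monotoneOn hu hx hux) (hφmono hx hy hxy)
      (hφmono.monotoneOn hy hw hyw)
    have h2 := slope_le_exp_mul_slope hlo K.coe_nonneg (hdiff hu hw) (hder hu hw) (hlip' hu hw)
      hux hxy hyw le_rfl huw le_rfl
    have h3 : Real.exp (K / lo * (w - u)) ≤ Real.exp (K / lo * (2 * ε)) := by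
      rw [Metric.mem_ball, Real.dist_eq, abs_lt] at hu hw
      gcongr
      linarith
    have h4 := h2.trans (mul_le_mul_of_nonneg_right h3 (hφpos u hu w hw huw).le)
    rw [hfslope x hx y hy hxy, hfslope u hu w hw huw]
    refine (mul_le_mul h1 h4 (hφpos x hx y hy hxy).le ?_).trans_eq (by ring)
    have := hqpos u hu w hw huw
    positivity
  · intro a b c d ha hd hab hbc hcd hx₀
    have hb := hsub ha hd ⟨hab.le, by linarith⟩
    have hc := hsub ha hd ⟨by linarith, hcd.le⟩
    have hx₀' := Metric.mem_ball_self (x := x₀) hε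
    apply crD_le_of_slope_mul_le hf.1.mono hab hbc hcd
    have h1 := slope_signedPow_mul_le hp (hφmono ha hb hab) (hφmono hb hc hbc)
      (hφmono hc hd hcd) (fun h => hx₀ ⟨(hφmono.le_iff_le ha hx₀').1 (h0.symm ▸ h.1),
        (hφmono.le_iff_le hx₀' hd).1 (h0.symm ▸ h.2)⟩)
    have h2 := slope_le_exp_mul_slope hlo K.coe_nonneg (hdiff ha hd) (hder ha hd) (hlip' ha hd)
      le_rfl hab (by linarith) le_rfl (hab.trans hbc) hcd.le
    have h3 := slope_le_exp_mul_slope hlo K.coe_nonneg (hdiff ha hd) (hder ha hd) (hlip' ha hd)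
      (by linarith) hcd le_rfl hab.le (hbc.trans hcd) le_rfl
    have h4 := mul_le_mul h2 h3 (hφpos c hc d hd hcd).le
      (mul_nonneg (Real.exp_pos _).le (hφpos a ha c hc (hab.trans hbc)).le)
    have h5 := mul_le_mul h1 h4
      (mul_nonneg (hφpos a ha b hb hab).le (hφpos c hc d hd hcd).le)
      (mul_nonneg (hqpos a ha c hc (hab.trans hbc)).le (hqpos b hb d hd (hbc.trans hcd)).le)
    rw [hfslope a ha b hb hab, hfslope c hc d hd hcd, hfslope a ha c hc (hab.trans hbc),
      hfslope b hb d hd (hbc.trans hcd), add_mul, Real.exp_add]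
    exact (le_of_eq (by ring)).trans (h5.trans_eq (by ring))

theorem measurableSet_exists_add_intCast_mem_Icc (a d : ℝ) :
    MeasurableSet {x : ℝ | ∃ k : ℤ, x + k ∈ Icc a d} := by
  rw [ofPred_exists]
  exact MeasurableSet.iUnion fun k => (measurable_id.add_const (k : ℝ)) measurableSet_Icc

theorem intervalIntegrable_indicator_one {A : Set ℝ} (hA : MeasurableSet A) (s t : ℝ) :
    IntervalIntegrable (A.indicator (1 : ℝ → ℝ)) MeasureTheory.volume s t := by
  rw [intervalIntegrable_iff]
  exact (MeasureTheory.integrableOn_const (by simp)).indicator hA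

theorem slope_add_intCast {f : ℝ → ℝ} (hper : ∀ x, f (x + 1) = f x + 1) (x y : ℝ) (k : ℤ) :
    slope f (x + k) (y + k) = slope f x y := by
  simp only [slope_def_field, map_add_intCast_of_periodic hper, add_sub_add_right_eq_sub]

theorem exists_slope_bounds {f : ℝ → ℝ} (hf : IsCircleMapLift f) {δ : ℝ} (hδ : 0 < δ) :
    ∃ Λ μ : ℝ, 0 ≤ Λ ∧ 0 < μ ∧ ∀ u x y w, u ∈ Icc (0 : ℝ) 1 → u ≤ x → x < y → y ≤ w →
      w ≤ u + 1 → u + δ ≤ w → slope f x y ≤ Λ ∧ μ ≤ slope f u w := by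
  have hcont : Continuous f := hf.smooth.continuous
  obtain ⟨Λ, hΛ⟩ := (isCompact_Icc (a := (0 : ℝ)) (b := 2)).exists_bound_of_continuousOn
    (hf.smooth.continuous_deriv (by norm_num)).continuousOn
  obtain ⟨v, -, hv⟩ := (isCompact_Icc (a := (0 : ℝ)) (b := 1)).exists_isMinOn
    (nonempty_Icc.2 zero_le_one)
    ((hcont.comp (continuous_id.add continuous_const)).sub hcont :
      Continuous fun u => f (u + δ) - f u).continuousOn
  refine ⟨Λ, f (v + δ) - f v, (norm_nonneg _).trans (hΛ 0 (by simp)),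
    sub_pos.2 (hf.mono (by linarith)), ?_⟩
  intro u x y w hu hux hxy hyw hw1 hw
  constructor
  · obtain ⟨z, hz, h⟩ := exists_deriv_eq_slope' f hxy hcont.continuousOn
      (hf.smooth.differentiable (by norm_num)).differentiableOn
    rw [← h]
    exact (le_abs_self _).trans (hΛ z ⟨by linarith [hu.1, hz.1], by linarith [hu.2, hz.2]⟩)
  · have h1 : f (v + δ) - f v ≤ f (u + δ) - f u := hv hu
    have h2 := hf.mono.monotone hw
    have h3 : 0 ≤ f w - f u := sub_nonneg.2 (hf.mono.monotone (by linarith))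
    rw [slope_def_field]
    exact (by linarith : _ ≤ f w - f u).trans (le_div_self h3 (by linarith) (by linarith))

theorem exists_uniform_bounds {f : ℝ → ℝ} {C : Finset ℝ} {dc : ℝ → ℝ}
    (hf : IsMulticriticalLift f C dc) :
    ∃ (S : Finset ℝ) (δ B K : ℝ), 0 < δ ∧ 0 ≤ B ∧ 0 ≤ K ∧
      (∀ u x y w, u ≤ x → x < y → y ≤ w → w ≤ u + 1 → slope f x y ≤ B * slope f u w) ∧
      (∀ a b c d, a < b → b < c → c < d → d < a + δ →
        (∀ s ∈ S, ∀ k : ℤ, s + k ∉ Icc a d) → crD f a b c d ≤ Real.exp (K * (d - a))) := by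
  choose ε B K hε hB hK hslope hcr using exists_local_bounds hf
  obtain ⟨S, -, hS⟩ := (isCompact_Icc (a := (0 : ℝ)) (b := 1)).elim_nhds_subcover
    (fun x => Metric.ball x (ε x)) fun x _ => Metric.ball_mem_nhds x (hε x)
  obtain ⟨δ, hδ, hleb⟩ := lebesgue_number_lemma_of_metric
    (isCompact_Icc (a := (0 : ℝ)) (b := 1)) (c := fun s : S => Metric.ball (s : ℝ) (ε s))
    (fun _ => Metric.isOpen_ball) (fun x hx => by simpa using hS hx)
  obtain ⟨Λ, μ, hΛ, hμ, hlarge⟩ := exists_slope_bounds hf.1 hδ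
  have hfract : ∀ u : ℝ, u + ((-⌊u⌋ : ℤ) : ℝ) ∈ Icc (0 : ℝ) 1 := fun u => by
    push_cast
    constructor <;> linarith [Int.floor_le u, Int.lt_floor_add_one u]
  have hsmall : ∀ u w, u ∈ Icc (0 : ℝ) 1 → u ≤ w → w < u + δ →
      ∃ s ∈ S, u ∈ Metric.ball s (ε s) ∧ w ∈ Metric.ball s (ε s) := by
    intro u w hu huw hw
    obtain ⟨⟨s, hs⟩, h⟩ := hleb u hu
    refine ⟨s, hs, h (Metric.mem_ball_self hδ), h ?_⟩
    rw [Metric.mem_ball, Real.dist_eq, abs_lt]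
    constructor <;> linarith
  have hB0 : 0 ≤ ∑ s ∈ S, B s := Finset.sum_nonneg fun s _ => hB s
  have hK0 : 0 ≤ ∑ s ∈ S, K s := Finset.sum_nonneg fun s _ => hK s
  have hper := hf.1.periodic
  refine ⟨S, δ, ∑ s ∈ S, B s + Λ / μ, ∑ s ∈ S, K s, hδ, by positivity, hK0, ?_, ?_⟩
  · intro u x y w hux hxy hyw hw1
    rw [← slope_add_intCast hper x y (-⌊u⌋), ← slope_add_intCast hper u w (-⌊u⌋)]
    have hu := hfract u
    generalize ((-⌊u⌋ : ℤ) : ℝ) = k at hu ⊢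
    have hpos : 0 < slope f (u + k) (w + k) :=
      slope_pos_of_strictMono hf.1.mono (by linarith)
    rw [add_mul]
    have hΛμ : 0 ≤ Λ / μ := by positivity
    rcases lt_or_ge (w + k) (u + k + δ) with h | h
    · obtain ⟨s, hs, hus, hws⟩ := hsmall _ _ hu (by linarith) h
      have h1 := hslope s (u + k) (x + k) (y + k) (w + k) hus hws (by linarith) (by linarith)
        (by linarith)
      have h2 := mul_le_mul_of_nonneg_right
        (Finset.single_le_sum (f := B) (fun s _ => hB s) hs) hpos.le
      have h3 := mul_nonneg hΛμ hpos.le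
      linarith
    · obtain ⟨h1, h2⟩ := hlarge (u + k) (x + k) (y + k) (w + k) hu (by linarith) (by linarith)
        (by linarith) (by linarith) h
      have h3 := mul_le_mul_of_nonneg_left h2 hΛμ
      rw [div_mul_cancel₀ _ hμ.ne'] at h3
      have h4 := mul_nonneg hB0 hpos.le
      linarith
  · intro a b c d hab hbc hcd hda hS'
    obtain ⟨s, hs, has, hds⟩ := hsmall _ (d + ((-⌊a⌋ : ℤ) : ℝ)) (hfract a) (by linarith)
      (by linarith)
    have h1 := hcr s _ (b + ((-⌊a⌋ : ℤ) : ℝ)) (c + ((-⌊a⌋ : ℤ) : ℝ)) _ has hds (by linarith)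
      (by linarith) (by linarith) (fun h => hS' s hs ⌊a⌋ (by
        push_cast at h
        exact ⟨by linarith [h.1], by linarith [h.2]⟩))
    rw [crD_eq_slope] at h1 ⊢
    simp only [slope_add_intCast hper, add_sub_add_right_eq_sub] at h1
    refine h1.trans (Real.exp_le_exp.2 (mul_le_mul_of_nonneg_right
      (Finset.single_le_sum (f := K) (fun s _ => hK s) hs) (by linarith)))

open Classical in
theorem exists_crD_le_exp {f : ℝ → ℝ} {C : Finset ℝ} {dc : ℝ → ℝ}
    (hf : IsMulticriticalLift f C dc) :
    ∃ (S : Finset ℝ) (K L : ℝ), 0 ≤ K ∧ 0 ≤ L ∧ ∀ a b c d, a < b → b < c → c < d → d - a ≤ 1 →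
      crD f a b c d ≤
        Real.exp (K * (d - a) + L * ∑ s ∈ S, if ∃ k : ℤ, s + k ∈ Icc a d then (1 : ℝ) else 0) := by
  obtain ⟨S, δ, B, K, hδ, hB, hK, hslope, hcr⟩ := exists_uniform_bounds hf
  set L := B * B
  have hL : 0 ≤ L := mul_nonneg hB hB
  refine ⟨S, K + L / δ, L, by positivity, hL, ?_⟩
  intro a b c d hab hbc hcd hda
  have hsum : 0 ≤ ∑ s ∈ S, if ∃ k : ℤ, s + k ∈ Icc a d then (1 : ℝ) else 0 :=
    Finset.sum_nonneg fun s _ => by split_ifs <;> norm_num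
  have hda0 : 0 < d - a := by linarith
  have hLδ : 0 ≤ L / δ * (d - a) := by positivity
  have hKd : 0 ≤ K * (d - a) := by positivity
  have hLS := mul_nonneg hL hsum
  have hbound : crD f a b c d ≤ Real.exp L := by
    refine le_trans ?_ ((le_add_of_nonneg_right zero_le_one).trans (Real.add_one_le_exp L))
    apply crD_le_of_slope_mul_le hf.1.mono hab hbc hcd
    have h1 := hslope a a b c le_rfl hab hbc.le (by linarith)
    have h2 := hslope b c d d hbc.le hcd le_rfl (by linarith)
    have h3 := mul_le_mul h1 h2 (slope_pos_of_strictMono hf.1.mono hcd).le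
      (mul_nonneg hB (slope_pos_of_strictMono hf.1.mono (hab.trans hbc)).le)
    exact h3.trans_eq (by ring)
  by_cases hlong : a + δ ≤ d
  · refine hbound.trans (Real.exp_le_exp.2 ?_)
    have : L ≤ L / δ * (d - a) := by
      calc L = L / δ * δ := by field_simp
        _ ≤ _ := by
          gcongr
          linarith
    linarith
  by_cases hmeet : ∃ s ∈ S, ∃ k : ℤ, s + k ∈ Icc a d
  · obtain ⟨s, hs, hk⟩ := hmeet
    refine hbound.trans (Real.exp_le_exp.2 ?_)
    have h1 : 1 ≤ ∑ s ∈ S, if ∃ k : ℤ, s + k ∈ Icc a d then (1 : ℝ) else 0 := by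
      refine le_trans ?_ (Finset.single_le_sum
        (f := fun s : ℝ => if ∃ k : ℤ, s + k ∈ Icc a d then (1 : ℝ) else 0)
        (fun s _ => by split_ifs <;> norm_num) hs)
      simp only [if_pos hk, le_refl]
    have := mul_le_mul_of_nonneg_left h1 hL
    linarith
  · push Not at hmeet
    refine (hcr a b c d hab hbc hcd (not_le.1 hlong) hmeet).trans (Real.exp_le_exp.2 ?_)
    linarith

/-- An arc of length at most one, seen as a subset of `[0, 1]`, has at least its full measure. -/
theorem sub_le_integral_indicator {a d : ℝ} (had : a ≤ d) (hda : d - a ≤ 1) :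
    d - a ≤ ∫ x in (0 : ℝ)..1, {x : ℝ | ∃ k : ℤ, x + k ∈ Icc a d}.indicator 1 x := by
  set A : Set ℝ := {x : ℝ | ∃ k : ℤ, x + k ∈ Icc a d}
  have hper : Function.Periodic (A.indicator (1 : ℝ → ℝ)) 1 := by
    intro x
    have : x + 1 ∈ A ↔ x ∈ A := by
      constructor
      · rintro ⟨k, hk⟩
        exact ⟨k + 1, by push_cast; rwa [← add_assoc, add_right_comm]⟩
      · rintro ⟨k, hk⟩
        exact ⟨k - 1, by push_cast; rwa [add_add_sub_cancel]⟩
    by_cases hx : x ∈ A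
    · rw [indicator_of_mem hx, indicator_of_mem (this.2 hx)]
      rfl
    · rw [indicator_of_notMem hx, indicator_of_notMem (fun h => hx (this.1 h))]
  have hmeas := measurableSet_exists_add_intCast_mem_Icc a d
  have hint : ∀ s t, IntervalIntegrable (A.indicator (1 : ℝ → ℝ)) MeasureTheory.volume s t :=
    intervalIntegrable_indicator_one hmeas
  have h1 := hper.intervalIntegral_add_eq 0 a
  rw [zero_add] at h1
  rw [h1, ← intervalIntegral.integral_add_adjacent_intervals (hint a d) (hint d (a + 1))]
  have h2 : ∫ x in a..d, A.indicator (1 : ℝ → ℝ) x = d - a := by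
    rw [intervalIntegral.integral_congr (g := fun _ => (1 : ℝ))]
    · simp
    · intro x hx
      rw [uIcc_of_le had] at hx
      exact indicator_of_mem (s := A) ⟨0, by simpa using hx⟩ 1
  have h3 : 0 ≤ ∫ x in d..(a + 1), A.indicator (1 : ℝ → ℝ) x :=
    intervalIntegral.integral_nonneg (by linarith)
      fun x _ => indicator_nonneg (fun _ _ => zero_le_one) x
  linarith

open Classical in
theorem sum_indicator_eq_ncard {ι : Type} [Fintype ι] (a d : ι → ℝ) (x : ℝ) :
    ∑ i, {x : ℝ | ∃ k : ℤ, x + k ∈ Icc (a i) (d i)}.indicator (1 : ℝ → ℝ) x =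
      (Set.ncard {i : ι | ∃ k : ℤ, x + (k : ℝ) ∈ Icc (a i) (d i)} : ℝ) := by
  rw [Set.ncard_eq_toFinset_card']
  simp [indicator_apply]

theorem sum_length_le {ι : Type} [Fintype ι] {a d : ι → ℝ} {m : ℕ}
    (had : ∀ i, a i ≤ d i ∧ d i - a i ≤ 1)
    (hm : ∀ x : ℝ, Set.ncard {i : ι | ∃ k : ℤ, x + (k : ℝ) ∈ Icc (a i) (d i)} ≤ m) :
    ∑ i, (d i - a i) ≤ m := by
  have hint : ∀ i, IntervalIntegrable
      ({x : ℝ | ∃ k : ℤ, x + k ∈ Icc (a i) (d i)}.indicator (1 : ℝ → ℝ))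
      MeasureTheory.volume 0 1 := fun i =>
    intervalIntegrable_indicator_one (measurableSet_exists_add_intCast_mem_Icc _ _) 0 1
  refine (Finset.sum_le_sum fun i _ => sub_le_integral_indicator (had i).1 (had i).2).trans ?_
  rw [← intervalIntegral.integral_finsetSum fun i _ => hint i]
  have hmono := intervalIntegral.integral_mono_on (zero_le_one (α := ℝ))
    (IntervalIntegrable.sum Finset.univ fun i _ => hint i)
    (intervalIntegrable_const (c := (m : ℝ))) (fun x _ => by
      rw [Finset.sum_apply, sum_indicator_eq_ncard]
      exact_mod_cast hm x)
  simpa using hmono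

/-- **The Cross-Ratio Inequality** (Świątek). For a multicritical circle map `f` with
irrational rotation number there is `C₀ = C₀(f) > 1` such that: whenever
`Mᵢ ⋐ Tᵢ ⊂ S¹` (realized in the lift as `Mᵢ = [bᵢ,cᵢ] ⋐ Tᵢ = [aᵢ,dᵢ]`, with
`dᵢ - aᵢ ≤ 1`), `i` in a finite index set, and each point of the circle belongs to at
most `m` of the `Tᵢ`, then `∏ᵢ CrD(f; Mᵢ, Tᵢ) ≤ C₀^m`. -/
theorem cross_ratio_inequality (f : ℝ → ℝ) (C : Finset ℝ) (dc : ℝ → ℝ) (ρ : ℝ)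
    (hf : GoodMap f C dc ρ) :
    ∃ C₀ : ℝ, 1 < C₀ ∧
      ∀ (ι : Type) [Fintype ι], ∀ (a b c d : ι → ℝ) (m : ℕ),
        (∀ i : ι, a i < b i ∧ b i < c i ∧ c i < d i ∧ d i - a i ≤ 1) →
        (∀ x : ℝ, Set.ncard {i : ι | ∃ k : ℤ, x + (k : ℝ) ∈ Icc (a i) (d i)} ≤ m) →
        ∏ i : ι, crD f (a i) (b i) (c i) (d i) ≤ C₀ ^ m := by

  classical
  obtain ⟨S, K, L, hK, hL, hbound⟩ := exists_crD_le_exp hf.1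
  have hpos : 0 < K + L * S.card + 1 := by positivity
  refine ⟨Real.exp (K + L * S.card + 1), Real.one_lt_exp_iff.2 hpos, ?_⟩
  intro ι _ a b c d m h hm
  have hlen := sum_length_le (fun i => ⟨by linarith [h i], (h i).2.2.2⟩) hm
  have hcount : ∑ i, ∑ s ∈ S, (if ∃ k : ℤ, s + k ∈ Icc (a i) (d i) then (1 : ℝ) else 0) ≤
      S.card * m := by
    rw [Finset.sum_comm, ← nsmul_eq_mul]
    refine Finset.sum_le_card_nsmul _ _ _ fun s _ => ?_
    have h1 := sum_indicator_eq_ncard a d s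
    simp only [indicator_apply, mem_ofPred_eq, Pi.one_apply] at h1
    rw [h1]
    exact_mod_cast hm s
  have hnonneg : ∀ i, 0 ≤ crD f (a i) (b i) (c i) (d i) := by
    intro i
    obtain ⟨h1, h2, h3, -⟩ := h i
    have hs := fun {x y : ℝ} (hxy : x < y) => (slope_pos_of_strictMono hf.1.1.mono hxy).le
    rw [crD_eq_slope]
    exact div_nonneg (mul_nonneg (hs h1) (hs h3))
      (mul_nonneg (hs (h1.trans h2)) (hs (h2.trans h3)))
  calc ∏ i, crD f (a i) (b i) (c i) (d i)
      ≤ ∏ i, Real.exp (K * (d i - a i) +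
          L * ∑ s ∈ S, if ∃ k : ℤ, s + k ∈ Icc (a i) (d i) then (1 : ℝ) else 0) :=
        Finset.prod_le_prod (fun i _ => hnonneg i) fun i _ =>
          hbound _ _ _ _ (h i).1 (h i).2.1 (h i).2.2.1 (h i).2.2.2
    _ ≤ Real.exp (K + L * S.card + 1) ^ m := by
      rw [← Real.exp_sum, ← Real.exp_nat_mul, Real.exp_le_exp, Finset.sum_add_distrib,
        ← Finset.mul_sum, ← Finset.mul_sum]
      have h1 := mul_le_mul_of_nonneg_left hlen hK
      have h2 := mul_le_mul_of_nonneg_left hcount hL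
      have h3 : (0 : ℝ) ≤ m := Nat.cast_nonneg m
      linarith
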